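/- Let n ≥ 1, let σ_0, σ_1, …, σ_n ∈ ℤ^n be nonzero vectors, and let v ∈ ℝ^n. For j ∈ {0, …, n} let σ^j be the n×n matrix with columns σ_0, …, σ_{j−1}, σ_{j+1}, …, σ_n (in that order) and D_j = det(σ^j), and define f_j : ℝ^n → ℂ by f_j(x) = e(⟨x, v⟩) · D_j / ∏_{k ≠ j} ⟨x, σ_k⟩ if ⟨x, σ_k⟩ ≠ 0 for all k ≠ j, and f_j(x) = 0 otherwise. Then for every x ∈ ℝ^n, Σ_{j=0}^{n} (−1)^j f_j(x) = Σ_{j=0}^{n} (−1)^j [⟨x, σ_j⟩ = 0] · f_j(x), where [⟨x, σ_j⟩ = 0] equals 1 if ⟨x, σ_j⟩ = 0 and 0 otherwise. Equivalently, Σ_{j=0}^{n} (−1)^j [⟨x, σ_j⟩ ≠ 0] · f_j(x) = 0 for all x ∈ ℝ^n. -/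

import Mathlib

open scoped Classical

/-- The term `f_j(x) = e(⟨x,v⟩) · D_j / ∏_{k ≠ j} ⟨x, σ_k⟩` if all the `⟨x, σ_k⟩`
(`k ≠ j`) are nonzero, and `0` otherwise.  Here `D_j` is the determinant of the matrix
with columns `σ_0, …, σ̂_j, …, σ_n`. -/
noncomputable def recipTerm (n : ℕ) (σ : Fin (n + 1) → Fin n → ℤ) (v : Fin n → ℝ)
    (j : Fin (n + 1)) (x : Fin n → ℝ) : ℂ :=
  if ∀ k, k ≠ j → (∑ i, x i * σ k i) ≠ 0 then
    Complex.exp (2 * (Real.pi : ℂ) * Complex.I * ((∑ i, x i * v i : ℝ) : ℂ)) *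
      (((Matrix.of fun i k => σ (j.succAbove k) i).det : ℤ) : ℂ) /
      ∏ k ∈ Finset.univ.erase j, ((∑ i, x i * σ k i : ℝ) : ℂ)
  else 0

/-- The signed maximal minors of an `n × (n + 1)` matrix are orthogonal to every linear
combination of its rows. -/
theorem sum_vecMul_mul_det_submatrix_succAbove {R : Type*} [CommRing R] {n : ℕ}
    (A : Matrix (Fin n) (Fin (n + 1)) R) (x : Fin n → R) :
    ∑ j : Fin (n + 1), (-1) ^ (j : ℕ) * (∑ i, x i * A i j) *
      (A.submatrix id j.succAbove).det = 0 := by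
  have row_minors (i : Fin n) : ∑ j : Fin (n + 1), (-1) ^ (j : ℕ) * A i j *
      (A.submatrix id j.succAbove).det = 0 := by
    have h : (Matrix.of (Fin.cons (A i) A : Fin (n + 1) → Fin (n + 1) → R)).det = 0 :=
      Matrix.det_zero_of_row_eq (Fin.succ_ne_zero i).symm rfl
    rwa [Matrix.det_succ_row_zero] at h
  calc
    _ = ∑ i, x i * ∑ j : Fin (n + 1), (-1) ^ (j : ℕ) * A i j *
        (A.submatrix id j.succAbove).det := by
      simp only [Finset.mul_sum, Finset.sum_mul]
      rw [Finset.sum_comm]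
      exact Finset.sum_congr rfl fun i _ => Finset.sum_congr rfl fun j _ => by ring
    _ = 0 := by simp [row_minors]

/-- If no `⟨x, σ_k⟩` vanishes, the alternating sum of the terms `f_j(x)` is zero. -/
theorem sum_neg_one_pow_mul_recipTerm_eq_zero {n : ℕ} (σ : Fin (n + 1) → Fin n → ℤ)
    (v x : Fin n → ℝ) (hx : ∀ k, (∑ i, x i * σ k i) ≠ 0) :
    ∑ j : Fin (n + 1), (-1 : ℂ) ^ (j : ℕ) * recipTerm n σ v j x = 0 := by
  set E := Complex.exp (2 * (Real.pi : ℂ) * Complex.I * ((∑ i, x i * v i : ℝ) : ℂ)) with hE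
  set p : Fin (n + 1) → ℂ := fun k => ((∑ i, x i * σ k i : ℝ) : ℂ) with hp
  have hp0 (k) : p k ≠ 0 := Complex.ofReal_ne_zero.mpr (hx k)
  let A : Matrix (Fin n) (Fin (n + 1)) ℂ := Matrix.of fun i j => (σ j i : ℂ)
  have minors := sum_vecMul_mul_det_submatrix_succAbove A fun i => (x i : ℂ)
  calc
    _ = ∑ j : Fin (n + 1), E / (∏ k, p k) * ((-1) ^ (j : ℕ) * (∑ i, (x i : ℂ) * A i j) *
        (A.submatrix id j.succAbove).det) := by
      refine Finset.sum_congr rfl fun j _ => ?_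
      have hprod : ∏ k ∈ Finset.univ.erase j, p k ≠ 0 :=
        Finset.prod_ne_zero_iff.mpr fun k _ => hp0 k
      have hdet : (((Matrix.of fun i k => σ (j.succAbove k) i).det : ℤ) : ℂ) =
          (A.submatrix id j.succAbove).det := by
        rw [Int.cast_det]
        rfl
      have hpj : ∑ i, (x i : ℂ) * A i j = p j := by simp [hp, A]
      rw [recipTerm, if_pos fun k _ => hx k, hdet, hpj, ← hE,
        ← Finset.mul_prod_erase _ p (Finset.mem_univ j)]
      have hpj0 := hp0 j
      change _ * (E * _ / ∏ k ∈ Finset.univ.erase j, p k) = _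
      field_simp
    _ = 0 := by rw [← Finset.mul_sum, minors, mul_zero]

/-- Pointwise form of the Dedekind reciprocity law:
`∑_j (-1)^j f_j(x) = ∑_j (-1)^j [⟨x,σ_j⟩ = 0] f_j(x)` for every `x ∈ ℝ^n`. -/
theorem dedekind_reciprocity_pointwise (n : ℕ) (hn : 1 ≤ n)
    (σ : Fin (n + 1) → Fin n → ℤ) (hσ : ∀ j, σ j ≠ 0) (v : Fin n → ℝ)
    (x : Fin n → ℝ) :
    ∑ j : Fin (n + 1), (-1 : ℂ) ^ (j : ℕ) * recipTerm n σ v j x =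
    ∑ j : Fin (n + 1), (-1 : ℂ) ^ (j : ℕ) *
      (if (∑ i, x i * σ j i) = 0 then (1 : ℂ) else 0) * recipTerm n σ v j x := by
  by_cases hx : ∀ k, (∑ i, x i * σ k i) ≠ 0
  · rw [sum_neg_one_pow_mul_recipTerm_eq_zero σ v x hx]
    simp [hx]
  · push Not at hx
    obtain ⟨k, hk⟩ := hx
    refine Finset.sum_congr rfl fun j _ => ?_
    by_cases hj : (∑ i, x i * σ j i) = 0
    · simp [hj]
    · have hkj : k ≠ j := by
        rintro rfl
        exact hj hk
      rw [recipTerm, if_neg fun h => h k hkj hk, mul_zero, mul_zero]
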